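/- arXiv:1606.01107 — 2 statements merged into one kernel-verified Lean document; each statement's English description precedes it below -/
import Mathlib

section
/- Let Θ = Θ_{ℓ1,…,ℓp} be a generalized theta graph with p ≥ 3. There exists a packing 4-coloring π of Θ with π(u) = π(v) = 3 if and only if n_1 = n_2 = n_3 = 0, n_5 ≤ 2 and n_5 + n_6 ≤ 4. -/
/-- A packing `k`-coloring of an undirected graph `G`: colors lie in `{1,…,k}` and
two distinct vertices sharing color `i` are at distance greater than `i`. -/
def IsPackingColoring {V : Type*} (G : SimpleGraph V) (k : ℕ) (π : V → ℕ) : Prop :=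
  (∀ x, 1 ≤ π x ∧ π x ≤ k) ∧
  ∀ x y : V, x ≠ y → π x = π y → (π x : ℕ∞) < G.edist x y

/-- The packing chromatic number of an undirected graph. -/
noncomputable def packingChromaticNumber {V : Type*} (G : SimpleGraph V) : ℕ :=
  sInf {k | ∃ π : V → ℕ, IsPackingColoring G k π}

/-- Vertices of the generalized theta graph `Θ_{ℓ 0, …, ℓ (p-1)}`:
`Sum.inl false` is the end-vertex `u`, `Sum.inl true` is the end-vertex `v`, and
`Sum.inr ⟨i, j⟩` is the internal vertex `x_i^{j+1}` of the `i`-th path. -/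
def ThetaVert (p : ℕ) (ℓ : Fin p → ℕ) : Type :=
  Bool ⊕ (Σ i : Fin p, Fin (ℓ i - 1))

/-- Base relation generating the edges of the generalized theta graph. -/
def thetaRel (p : ℕ) (ℓ : Fin p → ℕ) : ThetaVert p ℓ → ThetaVert p ℓ → Prop
  | Sum.inl a, Sum.inl b => a = false ∧ b = true ∧ ∃ i, ℓ i = 1
  | Sum.inl a, Sum.inr ⟨i, j⟩ =>
      (a = false ∧ (j : ℕ) = 0) ∨ (a = true ∧ (j : ℕ) + 2 = ℓ i)
  | Sum.inr ⟨i, j⟩, Sum.inr ⟨i', j'⟩ => (i : ℕ) = (i' : ℕ) ∧ (j : ℕ) + 1 = (j' : ℕ)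
  | Sum.inr _, Sum.inl _ => False

/-- The generalized theta graph `Θ_{ℓ 0, …, ℓ (p-1)}`. -/
def thetaGraph (p : ℕ) (ℓ : Fin p → ℕ) : SimpleGraph (ThetaVert p ℓ) :=
  SimpleGraph.fromRel (thetaRel p ℓ)

/-- The end-vertex `u` of the generalized theta graph. -/
def thetaU (p : ℕ) (ℓ : Fin p → ℕ) : ThetaVert p ℓ := Sum.inl false

/-- The end-vertex `v` of the generalized theta graph. -/
def thetaV (p : ℕ) (ℓ : Fin p → ℕ) : ThetaVert p ℓ := Sum.inl true

/-- `pathCount p ℓ m` is `n_m`, the number of paths of length `m`. -/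
def pathCount (p : ℕ) (ℓ : Fin p → ℕ) (m : ℕ) : ℕ :=
  (Finset.univ.filter (fun i : Fin p => ℓ i = m)).card

/-- `longPathCount p ℓ` is `Σ_{i ≥ 3} n_i`, the number of paths of length at least `3`. -/
def longPathCount (p : ℕ) (ℓ : Fin p → ℕ) : ℕ :=
  (Finset.univ.filter (fun i : Fin p => 3 ≤ ℓ i)).card

/-- Conditions (A)–(N) on the multiset of path lengths of a generalized theta graph. -/
def CondAN (p : ℕ) (ℓ : Fin p → ℕ) : Prop :=
  let n := pathCount p ℓ
  -- (A)
  (n 1 = 0 ∧ n 2 = 0 ∧ n 3 = 0 ∧ n 4 = 0) ∨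
  -- (B)
  (n 1 = 0 ∧ n 2 = 0 ∧ n 3 = 0 ∧ n 5 ≤ 2 ∧ n 5 + n 6 ≤ 4) ∨
  -- (C)
  (n 1 = 0 ∧ n 2 = 0 ∧ n 3 = 0 ∧ n 7 ≤ 1) ∨
  -- (D)
  (n 1 = 0 ∧ n 2 = 0 ∧ n 3 = 0 ∧ n 5 + n 6 + n 7 ≤ 2) ∨
  -- (E)
  (n 1 = 0 ∧ n 2 = 0 ∧ n 3 ≤ 1 ∧ n 5 = 0 ∧ n 6 = 0 ∧ n 7 = 0) ∨
  -- (F)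
  (n 1 = 0 ∧ n 2 = 0 ∧ n 3 ≤ 1 ∧ n 4 = 0 ∧ n 7 + n 8 ≤ 1) ∨
  -- (G)
  (n 1 = 0 ∧ n 3 = 0 ∧ n 4 = 0 ∧ n 7 ≤ 1 ∧ n 8 = 0) ∨
  -- (H)
  (n 1 = 0 ∧ n 3 ≤ 2 ∧ (n 5 = 0 ∨ n 5 + n 6 ≤ 1)) ∨
  -- (I)
  (n 1 = 0 ∧ n 3 + n 4 + n 5 ≤ 1) ∨
  -- (J)
  (n 1 ≤ 1 ∧ n 3 ≤ 2 ∧ n 5 = 0 ∧ n 6 = 0) ∨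
  -- (K)
  (n 1 ≤ 1 ∧ n 3 = 0 ∧ n 7 = 0) ∨
  -- (L)
  (n 1 ≤ 1 ∧ n 3 = 0 ∧ n 4 = 0 ∧ n 7 ≤ 1 ∧ n 8 = 0) ∨
  -- (M)
  (n 1 ≤ 1 ∧ n 3 ≤ 1 ∧ n 4 = 0 ∧ n 7 = 0 ∧ n 8 = 0) ∨
  -- (N)
  (n 1 ≤ 1 ∧ longPathCount p ℓ ≤ 1)

/-- `DirPath A m x y` holds when there is a directed walk of length `m`
from `x` to `y` following the arc relation `A`. -/
def DirPath {V : Type*} (A : V → V → Prop) : ℕ → V → V → Prop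
  | 0, x, y => x = y
  | m + 1, x, y => ∃ z, A x z ∧ DirPath A m z y

/-- The weak directed distance between `x` and `y`: the number of arcs in a shortest
directed path linking `x` and `y`, in either direction (`⊤` if none exists). -/
noncomputable def weakEDist {V : Type*} (A : V → V → Prop) (x y : V) : ℕ∞ :=
  sInf {n : ℕ∞ | ∃ m : ℕ, (DirPath A m x y ∨ DirPath A m y x) ∧ n = (m : ℕ∞)}

/-- A packing `k`-coloring of an oriented graph with arc relation `A`. -/
def IsDirPackingColoring {V : Type*} (A : V → V → Prop) (k : ℕ) (π : V → ℕ) : Prop :=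
  (∀ x, 1 ≤ π x ∧ π x ≤ k) ∧
  ∀ x y : V, x ≠ y → π x = π y → (π x : ℕ∞) < weakEDist A x y

/-- The packing chromatic number of an oriented graph with arc relation `A`. -/
noncomputable def dirPackingChromaticNumber {V : Type*} (A : V → V → Prop) : ℕ :=
  sInf {k | ∃ π : V → ℕ, IsDirPackingColoring A k π}

/-- `A` is an orientation of the undirected graph `G`: every edge of `G` receives
exactly one of its two possible directions. -/
def IsOrientation {V : Type*} (G : SimpleGraph V) (A : V → V → Prop) : Prop :=
  (∀ x y : V, G.Adj x y ↔ (A x y ∨ A y x)) ∧ (∀ x y : V, A x y → ¬ A y x)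

/-- Walks are at least as long as the increase of a 1-Lipschitz function. -/
theorem lip_le_edist {V : Type*} (G : SimpleGraph V) (f : V → ℕ)
    (hf : ∀ x y, G.Adj x y → f y ≤ f x + 1) (x y : V) (hx : f x = 0) :
    (f y : ℕ∞) ≤ G.edist x y := by
  have key : ∀ a b (w : G.Walk a b), f b ≤ f a + w.length := by
    intro a b w
    induction w with
    | nil => simp
    | cons h w ih =>
      have := hf _ _ h
      simp only [SimpleGraph.Walk.length_cons]
      omega
  rw [SimpleGraph.edist]
  refine le_iInf fun w => ?_
  have := key x y w
  rw [hx] at this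
  exact_mod_cast (by omega : f y ≤ w.length)

/-- The vertex at position `t` on path `i`. -/
def pv (p : ℕ) (ℓ : Fin p → ℕ) (i : Fin p) (t : ℕ) : ThetaVert p ℓ :=
  if h0 : t = 0 then Sum.inl false
  else if h : t < ℓ i then Sum.inr ⟨i, ⟨t - 1, by omega⟩⟩ else Sum.inl true

theorem pv_zero (p : ℕ) (ℓ : Fin p → ℕ) (i : Fin p) : pv p ℓ i 0 = Sum.inl false := rfl

theorem pv_mid (p : ℕ) (ℓ : Fin p → ℕ) (i : Fin p) (t : ℕ) (h : t + 1 < ℓ i) :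
    pv p ℓ i (t + 1) = Sum.inr ⟨i, ⟨t, by omega⟩⟩ := by
  unfold pv
  exact (dif_neg (by omega)).trans (dif_pos h)

theorem pv_last (p : ℕ) (ℓ : Fin p → ℕ) (i : Fin p) (t : ℕ) (h : ℓ i ≤ t) (h0 : 0 < t) :
    pv p ℓ i t = Sum.inl true := by
  unfold pv
  exact (dif_neg (by omega)).trans (dif_neg (by omega))

theorem pv_ne (p : ℕ) (ℓ : Fin p → ℕ) (i : Fin p) (t t' : ℕ) (h : t < t') (h' : t' ≤ ℓ i) :
    pv p ℓ i t ≠ pv p ℓ i t' := by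
  obtain ⟨s', rfl⟩ : ∃ s, t' = s + 1 := ⟨t' - 1, by omega⟩
  intro e
  rcases Nat.lt_or_ge (s' + 1) (ℓ i) with h1 | h1
  · rw [pv_mid p ℓ i s' h1] at e
    cases t with
    | zero => rw [pv_zero] at e; cases e
    | succ s =>
      rw [pv_mid p ℓ i s (by omega)] at e
      have := Sum.inr.inj e
      simp at this
      omega
  · rw [pv_last p ℓ i (s' + 1) h1 (by omega)] at e
    cases t with
    | zero => rw [pv_zero] at e; cases e
    | succ s => rw [pv_mid p ℓ i s (by omega)] at e; cases e

theorem pv_adj (p : ℕ) (ℓ : Fin p → ℕ) (i : Fin p) (t : ℕ) (h : t < ℓ i) :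
    (thetaGraph p ℓ).Adj (pv p ℓ i t) (pv p ℓ i (t + 1)) := by
  refine ⟨pv_ne p ℓ i t (t + 1) (by omega) (by omega), ?_⟩
  rcases Nat.lt_or_ge (t + 1) (ℓ i) with h1 | h1
  · rw [pv_mid p ℓ i t h1]
    cases t with
    | zero => rw [pv_zero]; exact Or.inl (Or.inl ⟨rfl, rfl⟩)
    | succ s => rw [pv_mid p ℓ i s (by omega)]; exact Or.inl ⟨rfl, rfl⟩
  · rw [pv_last p ℓ i (t + 1) h1 (by omega)]
    cases t with
    | zero => rw [pv_zero]; exact Or.inl ⟨rfl, rfl, i, by omega⟩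
    | succ s =>
      rw [pv_mid p ℓ i s (by omega)]
      refine Or.inr (Or.inr ⟨rfl, ?_⟩)
      change s + 2 = ℓ i
      omega

theorem pv_edist (p : ℕ) (ℓ : Fin p → ℕ) (i : Fin p) (t n : ℕ) (h : t + n ≤ ℓ i) :
    (thetaGraph p ℓ).edist (pv p ℓ i t) (pv p ℓ i (t + n)) ≤ n := by
  induction n with
  | zero => simp
  | succ n ih =>
    have h1 := ih (by omega)
    have h2 := pv_adj p ℓ i (t + n) (by omega)
    have h3 := SimpleGraph.edist_triangle (G := thetaGraph p ℓ) (u := pv p ℓ i t)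
      (v := pv p ℓ i (t + n)) (w := pv p ℓ i (t + n + 1))
    rw [SimpleGraph.edist_eq_one_iff_adj.2 h2] at h3
    refine h3.trans ?_
    push_cast
    gcongr

theorem pv_ne' (p : ℕ) (ℓ : Fin p → ℕ) (i i' : Fin p) (t t' : ℕ) (hi : i ≠ i') (h0 : 0 < t)
    (h : t < ℓ i) : pv p ℓ i t ≠ pv p ℓ i' t' := by
  obtain ⟨s, rfl⟩ : ∃ s, t = s + 1 := ⟨t - 1, by omega⟩
  intro e
  rw [pv_mid p ℓ i s h] at e
  cases t' with
  | zero => rw [pv_zero] at e; cases e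
  | succ s' =>
    rcases Nat.lt_or_ge (s' + 1) (ℓ i') with h1 | h1
    · rw [pv_mid p ℓ i' s' h1] at e
      have := Sum.inr.inj e
      simp at this
      exact hi this.1
    · rw [pv_last p ℓ i' (s' + 1) h1 (by omega)] at e
      cases e

theorem stmt5_forward (p : ℕ) (ℓ : Fin p → ℕ) (hp : 3 ≤ p) (hpos : ∀ i, 1 ≤ ℓ i)
    (π : ThetaVert p ℓ → ℕ) (hπ : IsPackingColoring (thetaGraph p ℓ) 4 π)
    (hu : π (thetaU p ℓ) = 3) (hv : π (thetaV p ℓ) = 3) :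
    (pathCount p ℓ 1 = 0 ∧ pathCount p ℓ 2 = 0 ∧ pathCount p ℓ 3 = 0 ∧ pathCount p ℓ 5 ≤ 2 ∧
      pathCount p ℓ 5 + pathCount p ℓ 6 ≤ 4) := by
  obtain ⟨c, hc⟩ : ∃ c : Fin p → ℕ → ℕ, ∀ i t, c i t = π (pv p ℓ i t) := ⟨_, fun _ _ => rfl⟩
  have c0 : ∀ i, c i 0 = 3 := by
    intro i; rw [hc]; simpa [pv, thetaU] using hu
  have cl : ∀ i, c i (ℓ i) = 3 := by
    intro i; rw [hc]
    have := hpos i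
    have h0 : ℓ i ≠ 0 := by omega
    simpa [pv, thetaV, h0] using hv
  have cr : ∀ i t, 1 ≤ c i t ∧ c i t ≤ 4 := by
    intro i t; rw [hc]; exact hπ.1 _
  have cs : ∀ i t n, 0 < n → t + n ≤ ℓ i → c i t = c i (t + n) → c i t < n := by
    intro i t n hn h e
    rw [hc, hc] at e
    have h1 := hπ.2 _ _ (pv_ne p ℓ i t (t + n) (by omega) h) e
    have h2 := h1.trans_le (pv_edist p ℓ i t n h)
    rw [hc]
    exact_mod_cast h2
  have cu : ∀ i i' t t', i ≠ i' → 0 < t → t < ℓ i → 0 < t' → t' < ℓ i' → c i t = c i' t' →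
      c i t < t + t' := by
    intro i i' t t' hi h0 h h0' h' e
    rw [hc, hc] at e
    have h1 := hπ.2 _ _ (pv_ne' p ℓ i i' t t' hi h0 h) e
    have a := pv_edist p ℓ i 0 t (by omega)
    have b := pv_edist p ℓ i' 0 t' (by omega)
    have h3 := SimpleGraph.edist_triangle (G := thetaGraph p ℓ) (u := pv p ℓ i t)
      (v := pv p ℓ i 0) (w := pv p ℓ i' t')
    have e0 : pv p ℓ i' 0 = pv p ℓ i 0 := rfl
    rw [SimpleGraph.edist_comm, zero_add] at a
    rw [e0, zero_add] at b
    have h4 := h1.trans_le (h3.trans (add_le_add a b))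
    rw [hc]
    exact_mod_cast h4
  have cv : ∀ i i' t t', i ≠ i' → 0 < t → t < ℓ i → 0 < t' → t' < ℓ i' → c i t = c i' t' →
      c i t < (ℓ i - t) + (ℓ i' - t') := by
    intro i i' t t' hi h0 h h0' h' e
    rw [hc, hc] at e
    have h1 := hπ.2 _ _ (pv_ne' p ℓ i i' t t' hi h0 h) e
    have a := pv_edist p ℓ i t (ℓ i - t) (by omega)
    have b := pv_edist p ℓ i' t' (ℓ i' - t') (by omega)
    rw [Nat.add_sub_cancel' (by omega)] at a b
    have h3 := SimpleGraph.edist_triangle (G := thetaGraph p ℓ) (u := pv p ℓ i t)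
      (v := pv p ℓ i (ℓ i)) (w := pv p ℓ i' t')
    have e0 : pv p ℓ i' (ℓ i') = pv p ℓ i (ℓ i) := by
      rw [pv_last p ℓ i _ le_rfl (by omega), pv_last p ℓ i' _ le_rfl (by omega)]
    rw [SimpleGraph.edist_comm, e0] at b
    have h4 := h1.trans_le (h3.trans (add_le_add a b))
    rw [hc]
    exact_mod_cast h4
  have l4 : ∀ i, 4 ≤ ℓ i := by
    intro i
    have := cs i 0 (ℓ i) (hpos i) (by omega) (by rw [zero_add, c0, cl])
    rw [c0] at this
    omega
  have zero : ∀ m, m < 4 → pathCount p ℓ m = 0 := by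
    intro m hm
    rw [pathCount, Finset.card_eq_zero, Finset.filter_eq_empty_iff]
    intro i _
    have := l4 i
    omega
  refine ⟨zero 1 (by omega), zero 2 (by omega), zero 3 (by omega), ?_⟩
  -- classification of short paths
  have ty5 : ∀ i, ℓ i = 5 → (∃ t, 0 < t ∧ t ≤ 2 ∧ c i t = 4) ∨
      (∃ t, t < ℓ i ∧ ℓ i ≤ t + 2 ∧ c i t = 4) := by
    intro i hi
    by_contra hcon
    push Not at hcon
    obtain ⟨hA, hB⟩ := hcon
    have a1 := hA 1 (by omega) (by omega)
    have a2 := hA 2 (by omega) (by omega)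
    have a3 := hB 3 (by omega) (by omega)
    have a4 := hB 4 (by omega) (by omega)
    have r1 := cr i 1
    have r2 := cr i 2
    have r3 := cr i 3
    have r4 := cr i 4
    have z := c0 i
    have l := cl i
    rw [hi] at l
    have h01 := cs i 0 1 (by omega) (by omega)
    have h02 := cs i 0 2 (by omega) (by omega)
    have h35 := cs i 3 2 (by omega) (by omega)
    have h45 := cs i 4 1 (by omega) (by omega)
    have h12 := cs i 1 1 (by omega) (by omega)
    have h13 := cs i 1 2 (by omega) (by omega)
    have h23 := cs i 2 1 (by omega) (by omega)
    have h24 := cs i 2 2 (by omega) (by omega)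
    have h34 := cs i 3 1 (by omega) (by omega)
    norm_num at *
    omega
  have ty6 : ∀ i, ℓ i = 6 → (∃ t, 0 < t ∧ t ≤ 2 ∧ c i t = 4) ∨
      (∃ t, t < ℓ i ∧ ℓ i ≤ t + 2 ∧ c i t = 4) ∨ c i 1 = 2 ∨ c i (ℓ i - 1) = 2 := by
    intro i hi
    by_contra hcon
    push Not at hcon
    obtain ⟨hA, hB, b1, b5⟩ := hcon
    have a1 := hA 1 (by omega) (by omega)
    have a2 := hA 2 (by omega) (by omega)
    have a4 := hB 4 (by omega) (by omega)
    have a5 := hB 5 (by omega) (by omega)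
    have r1 := cr i 1
    have r2 := cr i 2
    have r3 := cr i 3
    have r4 := cr i 4
    have r5 := cr i 5
    have z := c0 i
    have l := cl i
    rw [hi] at l b5
    have h01 := cs i 0 1 (by omega) (by omega)
    have h02 := cs i 0 2 (by omega) (by omega)
    have h03 := cs i 0 3 (by omega) (by omega)
    have h46 := cs i 4 2 (by omega) (by omega)
    have h56 := cs i 5 1 (by omega) (by omega)
    have h12 := cs i 1 1 (by omega) (by omega)
    have h23 := cs i 2 1 (by omega) (by omega)
    have h24 := cs i 2 2 (by omega) (by omega)
    have h34 := cs i 3 1 (by omega) (by omega)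
    have h45 := cs i 4 1 (by omega) (by omega)
    norm_num at *
    omega
  let P : ℕ → Fin p → Prop := fun k i =>
    (k = 0 ∧ ∃ t, 0 < t ∧ t ≤ 2 ∧ c i t = 4) ∨ (k = 1 ∧ ∃ t, t < ℓ i ∧ ℓ i ≤ t + 2 ∧ c i t = 4) ∨
    (k = 2 ∧ c i 1 = 2) ∨ (k = 3 ∧ c i (ℓ i - 1) = 2)
  have Pinj : ∀ k i i', P k i → P k i' → i = i' := by
    intro k i i' h h'
    by_contra hne
    have g := l4 i
    have g' := l4 i'
    rcases h with ⟨hk, t, h1, h2, h3⟩ | ⟨hk, t, h1, h2, h3⟩ | ⟨hk, h1⟩ | ⟨hk, h1⟩ <;>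
    rcases h' with ⟨hk', t', h1', h2', h3'⟩ | ⟨hk', t', h1', h2', h3'⟩ | ⟨hk', h1'⟩ | ⟨hk', h1'⟩ <;>
    first | omega | skip
    · have := cu i i' t t' hne (by omega) (by omega) (by omega) (by omega) (by omega)
      omega
    · have := cv i i' t t' hne (by omega) (by omega) (by omega) (by omega) (by omega)
      omega
    · have := cu i i' 1 1 hne (by omega) (by omega) (by omega) (by omega) (by omega)
      omega
    · have := cv i i' (ℓ i - 1) (ℓ i' - 1) hne (by omega) (by omega) (by omega) (by omega)
        (by omega)
      omega
  have bound : ∀ (S : Finset (Fin p)) (n : ℕ), (∀ i ∈ S, ∃ k < n, P k i) → S.card ≤ n := by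
    intro S n h
    choose! k hk hP using h
    have := Finset.card_le_card_of_injOn (s := S) (t := Finset.range n) k
      (by intro i hi; simpa using hk i hi)
      (by
        intro i hi i' hi' e
        have h1 := hP i hi
        rw [e] at h1
        exact Pinj _ _ _ h1 (hP i' hi'))
    simpa using this
  constructor
  · refine bound _ _ ?_
    intro i hi
    simp only [Finset.mem_filter, Finset.mem_univ, true_and] at hi
    rcases ty5 i hi with h | h
    · exact ⟨0, by omega, Or.inl ⟨rfl, h⟩⟩
    · exact ⟨1, by omega, Or.inr (Or.inl ⟨rfl, h⟩)⟩
  · rw [pathCount, pathCount, ← Finset.card_union_of_disjoint]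
    · refine bound _ _ ?_
      intro i hi
      simp only [Finset.mem_union, Finset.mem_filter, Finset.mem_univ, true_and] at hi
      rcases hi with hi | hi
      · rcases ty5 i hi with h | h
        · exact ⟨0, by omega, Or.inl ⟨rfl, h⟩⟩
        · exact ⟨1, by omega, Or.inr (Or.inl ⟨rfl, h⟩)⟩
      · rcases ty6 i hi with h | h | h | h
        · exact ⟨0, by omega, Or.inl ⟨rfl, h⟩⟩
        · exact ⟨1, by omega, Or.inr (Or.inl ⟨rfl, h⟩)⟩
        · exact ⟨2, by omega, Or.inr (Or.inr (Or.inl ⟨rfl, h⟩))⟩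
        · exact ⟨3, by omega, Or.inr (Or.inr (Or.inr ⟨rfl, h⟩))⟩
    · rw [Finset.disjoint_filter]
      intro i _ h
      omega

/-- The periodic pattern `3 1 2 1 3 1 2 1 …`. -/
def pat (s : ℕ) : ℕ := if s % 4 = 0 then 3 else if s % 4 = 2 then 2 else 1

/-- Patterns for the various path types. -/
def patA (t : ℕ) : ℕ := if t = 2 then 4 else if t = 3 then 2 else 1

/-- Another pattern. -/
def patB (t : ℕ) : ℕ := if t = 2 then 4 else if t = 4 then 2 else 1

/-- Another pattern. -/
def patC (t : ℕ) : ℕ := if t = 3 then 4 else if t = 2 ∨ t = 5 then 2 else 1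

/-- Another pattern. -/
def patD (t : ℕ) : ℕ := if t = 3 then 4 else if t = 1 ∨ t = 4 then 2 else 1

/-- Another pattern. -/
def patE (t : ℕ) : ℕ :=
  if t < 5 then (if t = 3 then 4 else if t = 2 then 2 else 1) else pat (t - 5)

/-- Another pattern. -/
def patF (t : ℕ) : ℕ :=
  if t < 6 then (if t = 4 then 4 else if t = 2 then 2 else 1) else pat (t - 6)

/-- Another pattern. -/
def patG (t : ℕ) : ℕ :=
  if t < 7 then (if t = 4 then 4 else if t = 2 ∨ t = 5 then 2 else 1) else pat (t - 7)

/-- The color at position `t` of a path of length `L` with rank `r`. -/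
def colr (L r : ℕ) : ℕ → ℕ :=
  if L = 5 ∧ r = 0 then patA
  else if L = 6 ∧ r = 0 then patB
  else if L = 6 ∧ r = 2 then patC
  else if L = 6 ∧ r = 3 then patD
  else if L % 4 = 0 then pat
  else if L % 4 = 1 then patE
  else if L % 4 = 2 then patF
  else patG

theorem colr_cases (L r : ℕ) :
    (L = 5 ∧ r = 0 ∧ colr L r = patA) ∨ (L = 6 ∧ r = 0 ∧ colr L r = patB) ∨
    (L = 6 ∧ r = 2 ∧ colr L r = patC) ∨ (L = 6 ∧ r = 3 ∧ colr L r = patD) ∨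
    (L % 4 = 0 ∧ 0 = 0 ∧ colr L r = pat) ∨ (L % 4 = 1 ∧ (L = 5 → r ≠ 0) ∧ colr L r = patE) ∨
    (L % 4 = 2 ∧ (L = 6 → r ≠ 0 ∧ r ≠ 2 ∧ r ≠ 3) ∧ colr L r = patF) ∨
    (L % 4 = 3 ∧ 0 = 0 ∧ colr L r = patG) := by
  unfold colr
  split_ifs <;> simp_all <;> omega

theorem colr_range (L r t : ℕ) : 1 ≤ colr L r t ∧ colr L r t ≤ 4 := by
  rcases colr_cases L r with ⟨_, _, h⟩ | ⟨_, _, h⟩ | ⟨_, _, h⟩ | ⟨_, _, h⟩ | ⟨_, _, h⟩ |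
    ⟨_, _, h⟩ | ⟨_, _, h⟩ | ⟨_, _, h⟩ <;> rw [h] <;>
    simp only [patA, patB, patC, patD, patE, patF, patG, pat] <;> split_ifs <;> omega

theorem colr_same (L r t t' : ℕ) (h0 : 0 < t) (h : t < t') (h' : t' < L)
    (e : colr L r t = colr L r t') : colr L r t + t < t' := by
  rcases colr_cases L r with ⟨_, _, h⟩ | ⟨_, _, h⟩ | ⟨_, _, h⟩ | ⟨_, _, h⟩ | ⟨_, _, h⟩ |
    ⟨_, _, h⟩ | ⟨_, _, h⟩ | ⟨_, _, h⟩ <;> rw [h] at e ⊢ <;>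
    simp only [patA, patB, patC, patD, patE, patF, patG, pat] at e ⊢ <;>
    split_ifs at e ⊢ <;> omega

theorem colr_two (L r t : ℕ) (hL : 4 ≤ L) (h0 : 0 < t) (h : t < L) (e : colr L r t = 2) :
    (2 ≤ t ∨ (L = 6 ∧ r = 3)) ∧ (t + 2 ≤ L ∨ (L = 6 ∧ r = 2)) := by
  rcases colr_cases L r with ⟨_, _, h⟩ | ⟨_, _, h⟩ | ⟨_, _, h⟩ | ⟨_, _, h⟩ | ⟨_, _, h⟩ |
    ⟨_, _, h⟩ | ⟨_, _, h⟩ | ⟨_, _, h⟩ <;> rw [h] at e <;>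
    simp only [patA, patB, patC, patD, patE, patF, patG, pat] at e <;>
    split_ifs at e <;> omega

theorem colr_three (L r t : ℕ) (hL : 4 ≤ L) (h0 : 0 < t) (h : t < L) (e : colr L r t = 3) :
    4 ≤ t ∧ t + 4 ≤ L := by
  rcases colr_cases L r with ⟨_, _, h⟩ | ⟨_, _, h⟩ | ⟨_, _, h⟩ | ⟨_, _, h⟩ | ⟨_, _, h⟩ |
    ⟨_, _, h⟩ | ⟨_, _, h⟩ | ⟨_, _, h⟩ <;> rw [h] at e <;>
    simp only [patA, patB, patC, patD, patE, patF, patG, pat] at e <;>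
    split_ifs at e <;> omega

theorem colr_four (L r t : ℕ) (hL : 4 ≤ L) (h0 : 0 < t) (h : t < L) (e : colr L r t = 4)
    (h5 : L = 5 → r < 2) (h6 : L = 6 → r < 4) :
    2 ≤ t ∧ t + 2 ≤ L ∧ (3 ≤ t ∨ ((L = 5 ∨ L = 6) ∧ r = 0)) ∧
      (t + 3 ≤ L ∨ ((L = 5 ∨ L = 6) ∧ r = 1)) := by
  rcases colr_cases L r with ⟨_, _, h⟩ | ⟨_, _, h⟩ | ⟨_, _, h⟩ | ⟨_, _, h⟩ | ⟨_, _, h⟩ |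
    ⟨_, _, h⟩ | ⟨_, _, h⟩ | ⟨_, _, h⟩ <;> rw [h] at e <;>
    simp only [patA, patB, patC, patD, patE, patF, patG, pat] at e <;>
    split_ifs at e <;> omega

/-- A lower bound for the distance to the vertex at position `t₀` of path `i₀`; the numbers
`A` and `B` are lower bounds for its distances to the end-vertices. -/
def dfun (p : ℕ) (ℓ : Fin p → ℕ) (i₀ : Fin p) (t₀ A B : ℕ) : ThetaVert p ℓ → ℕ
  | Sum.inl false => A
  | Sum.inl true => B
  | Sum.inr ⟨i, j⟩ =>
    if i = i₀ then
      min (min (A + (j + 1)) (B + (ℓ i - (j + 1)))) ((t₀ - (j + 1)) + ((j + 1) - t₀))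
    else min (A + (j + 1)) (B + (ℓ i - (j + 1)))

theorem dfun_lip (p : ℕ) (ℓ : Fin p → ℕ) (h4 : ∀ i, 4 ≤ ℓ i) (i₀ : Fin p) (t₀ A B : ℕ)
    (hAB : A ≤ B + 4) (hBA : B ≤ A + 4) (hA : A ≤ t₀) (hB : B + t₀ ≤ ℓ i₀)
    (x y : ThetaVert p ℓ) (hxy : (thetaGraph p ℓ).Adj x y) :
    dfun p ℓ i₀ t₀ A B y ≤ dfun p ℓ i₀ t₀ A B x + 1 := by
  have key : ∀ x y, thetaRel p ℓ x y →
      dfun p ℓ i₀ t₀ A B y ≤ dfun p ℓ i₀ t₀ A B x + 1 ∧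
      dfun p ℓ i₀ t₀ A B x ≤ dfun p ℓ i₀ t₀ A B y + 1 := by
    intro x y hr
    match x, y, hr with
    | Sum.inl a, Sum.inl b, ⟨_, _, i, hi⟩ => have := h4 i; omega
    | Sum.inl a, Sum.inr ⟨i, j⟩, hr =>
      have g := h4 i
      have hj := j.2
      rcases hr with ⟨rfl, hj0⟩ | ⟨rfl, hj0⟩
      · by_cases hi : i = i₀
        · subst hi
          simp only [dfun, if_true]
          omega
        · simp only [dfun, hi, if_false]
          omega
      · by_cases hi : i = i₀
        · subst hi
          simp only [dfun, if_true]
          omega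
        · simp only [dfun, hi, if_false]
          omega
    | Sum.inr ⟨i, j⟩, Sum.inr ⟨i', j'⟩, ⟨hi, hj⟩ =>
      have hi := Fin.ext hi
      subst hi
      have hj1 := j.2
      have hj2 := j'.2
      by_cases hi : i = i₀
      · subst hi
        simp only [dfun, if_true]
        omega
      · simp only [dfun, hi, if_false]
        omega
  rcases hxy.2 with h | h
  · exact (key _ _ h).1
  · exact (key _ _ h).2

/-- The number of earlier paths of length at least five. -/
def rnk (p : ℕ) (ℓ : Fin p → ℕ) (i : Fin p) : ℕ :=
  (Finset.univ.filter (fun j : Fin p => j < i ∧ 5 ≤ ℓ j)).card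

theorem rnk_lt (p : ℕ) (ℓ : Fin p → ℕ) (i i' : Fin p) (h : i < i') (h5 : 5 ≤ ℓ i) :
    rnk p ℓ i < rnk p ℓ i' := by
  refine Finset.card_lt_card ?_
  rw [Finset.ssubset_iff_of_subset]
  · exact ⟨i, by simp [h, h5], by simp⟩
  · intro j hj
    simp only [Finset.mem_filter, Finset.mem_univ, true_and] at *
    exact ⟨hj.1.trans h, hj.2⟩

theorem rnk_inj (p : ℕ) (ℓ : Fin p → ℕ) (i i' : Fin p) (h5 : 5 ≤ ℓ i) (h5' : 5 ≤ ℓ i')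
    (e : rnk p ℓ i = rnk p ℓ i') : i = i' := by
  rcases lt_trichotomy i i' with h | h | h
  · have := rnk_lt p ℓ _ _ h h5
    omega
  · exact h
  · have := rnk_lt p ℓ _ _ h h5'
    omega

theorem rnk_five (p : ℕ) (ℓ : Fin p → ℕ) (hmono : Monotone ℓ) (i : Fin p) (hi : ℓ i = 5) :
    rnk p ℓ i < pathCount p ℓ 5 := by
  refine Finset.card_lt_card ?_
  rw [Finset.ssubset_iff_of_subset]
  · exact ⟨i, by simp [hi], by simp⟩
  · intro j hj
    simp only [Finset.mem_filter, Finset.mem_univ, true_and] at *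
    have := hmono hj.1.le
    omega

theorem rnk_six (p : ℕ) (ℓ : Fin p → ℕ) (hmono : Monotone ℓ) (i : Fin p) (hi : ℓ i = 6) :
    rnk p ℓ i < pathCount p ℓ 5 + pathCount p ℓ 6 := by
  rw [pathCount, pathCount, ← Finset.card_union_of_disjoint]
  · refine Finset.card_lt_card ?_
    rw [Finset.ssubset_iff_of_subset]
    · exact ⟨i, by simp [hi], by simp⟩
    · intro j hj
      simp only [Finset.mem_union, Finset.mem_filter, Finset.mem_univ, true_and] at *
      have := hmono hj.1.le
      omega
  · rw [Finset.disjoint_filter]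
    intro i _ h
    omega

/-- The packing coloring. -/
def thcol (p : ℕ) (ℓ : Fin p → ℕ) : ThetaVert p ℓ → ℕ
  | Sum.inl _ => 3
  | Sum.inr ⟨i, j⟩ => colr (ℓ i) (rnk p ℓ i) (j + 1)

theorem num_fin (c L t L' t' A B : ℕ) (hc : c ≤ 4) (h0 : 0 < t') (h1 : t' < L')
    (hu : c < t + t') (hv : c + t + t' < L + L') (hA : t ≤ A ∨ 5 ≤ A) (hB : L ≤ B + t ∨ 5 ≤ B) :
    c < min (A + t') (B + (L' - t')) := by
  refine lt_min ?_ ?_ <;> omega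

theorem num_two (L L' r r' t t' : ℕ) (h0 : 0 < t) (h1 : t < L) (h0' : 0 < t') (h1' : t' < L')
    (a : (2 ≤ t ∨ (L = 6 ∧ r = 3)) ∧ (t + 2 ≤ L ∨ (L = 6 ∧ r = 2)))
    (b : (2 ≤ t' ∨ (L' = 6 ∧ r' = 3)) ∧ (t' + 2 ≤ L' ∨ (L' = 6 ∧ r' = 2)))
    (inj : 5 ≤ L → 5 ≤ L' → r ≠ r') : 2 < t + t' ∧ 2 + t + t' < L + L' := by
  obtain ⟨a1, a2⟩ := a
  obtain ⟨b1, b2⟩ := b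
  constructor
  · clear a2 b2
    rcases a1 with a | a <;> rcases b1 with b | b <;> try omega
  · clear a1 b1
    rcases a2 with a | a <;> rcases b2 with b | b <;> try omega

theorem num_four (L L' r r' t t' : ℕ)
    (a : 2 ≤ t ∧ t + 2 ≤ L ∧ (3 ≤ t ∨ ((L = 5 ∨ L = 6) ∧ r = 0)) ∧
      (t + 3 ≤ L ∨ ((L = 5 ∨ L = 6) ∧ r = 1)))
    (b : 2 ≤ t' ∧ t' + 2 ≤ L' ∧ (3 ≤ t' ∨ ((L' = 5 ∨ L' = 6) ∧ r' = 0)) ∧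
      (t' + 3 ≤ L' ∨ ((L' = 5 ∨ L' = 6) ∧ r' = 1)))
    (inj : 5 ≤ L → 5 ≤ L' → r ≠ r') : 4 < t + t' ∧ 4 + t + t' < L + L' := by
  obtain ⟨a3, a4, a1, a2⟩ := a
  obtain ⟨b3, b4, b1, b2⟩ := b
  constructor
  · clear a2 b2
    rcases a1 with a | a <;> rcases b1 with b | b <;> try omega
  · clear a1 b1
    rcases a2 with a | a <;> rcases b2 with b | b <;> try omega

set_option maxHeartbeats 1000000 in
theorem stmt5_backward (p : ℕ) (ℓ : Fin p → ℕ) (hp : 3 ≤ p) (hmono : Monotone ℓ)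
    (h4 : ∀ i, 4 ≤ ℓ i) (h5 : pathCount p ℓ 5 ≤ 2)
    (h6 : pathCount p ℓ 5 + pathCount p ℓ 6 ≤ 4) :
    IsPackingColoring (thetaGraph p ℓ) 4 (thcol p ℓ) := by
  constructor
  · intro x
    match x with
    | Sum.inl _ => simp [thcol]
    | Sum.inr ⟨i, j⟩ => exact colr_range _ _ _
  have uv : (3 : ℕ∞) < (thetaGraph p ℓ).edist (Sum.inl false) (Sum.inl true) := by
    have i₀ : Fin p := ⟨0, by omega⟩
    have g := h4 i₀
    have h1 := lip_le_edist (thetaGraph p ℓ) (dfun p ℓ i₀ 0 0 4)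
      (dfun_lip p ℓ h4 i₀ 0 0 4 (by omega) (by omega) (by omega) (by omega)) (Sum.inl false) (Sum.inl true)
      (by simp [dfun])
    refine lt_of_lt_of_le ?_ h1
    have : 3 < dfun p ℓ i₀ 0 0 4 (Sum.inl true) := by
      simp only [dfun]
      omega
    exact_mod_cast this
  have main : ∀ (i : Fin p) (j : Fin (ℓ i - 1)) (y : ThetaVert p ℓ),
      (Sum.inr ⟨i, j⟩ : ThetaVert p ℓ) ≠ y → thcol p ℓ (Sum.inr ⟨i, j⟩) = thcol p ℓ y →
      (thcol p ℓ (Sum.inr ⟨i, j⟩) : ℕ∞) < (thetaGraph p ℓ).edist (Sum.inr ⟨i, j⟩) y := by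
    intro i j y hne e
    have hj := j.2
    have g := h4 i
    obtain ⟨A, B, hAB, hBA, hA, hB, hA', hB'⟩ : ∃ A B : ℕ, A ≤ B + 4 ∧ B ≤ A + 4 ∧
        A ≤ (j : ℕ) + 1 ∧ B + (j + 1) ≤ ℓ i ∧ ((j : ℕ) + 1 ≤ A ∨ 5 ≤ A) ∧
        (ℓ i ≤ B + (j + 1) ∨ 5 ≤ B) := by
      refine ⟨min (j + 1) (ℓ i - (j + 1) + 4), min (ℓ i - (j + 1)) (j + 1 + 4), ?_⟩
      omega
    have h1 := lip_le_edist (thetaGraph p ℓ) (dfun p ℓ i (j + 1) A B)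
      (dfun_lip p ℓ h4 i (j + 1) A B hAB hBA hA hB) (Sum.inr ⟨i, j⟩) y
      (by simp [dfun])
    refine lt_of_lt_of_le ?_ h1
    suffices thcol p ℓ (Sum.inr ⟨i, j⟩) < dfun p ℓ i (j + 1) A B y by exact_mod_cast this
    match y, hne, e with
    | Sum.inl b, hne, e =>
      simp only [thcol] at *
      have := colr_three _ _ _ g (by omega) (by omega) e
      rw [e]
      cases b <;> simp only [dfun] <;> omega
    | Sum.inr ⟨i', j'⟩, hne, e =>
      have hj' := j'.2
      have g' := h4 i'
      have r := colr_range (ℓ i) (rnk p ℓ i) (j + 1)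
      by_cases hi : i' = i
      · subst hi
        have hjj : (j : ℕ) ≠ j' := by
          intro h
          exact hne (by rw [Fin.ext h])
        simp only [thcol, dfun, if_true] at *
        rcases lt_or_gt_of_ne hjj with h | h
        · have := colr_same _ _ _ _ (by omega) (by omega) (by omega) e
          refine lt_min (lt_min ?_ ?_) ?_ <;> omega
        · have := colr_same _ _ _ _ (by omega) (by omega) (by omega) e.symm
          refine lt_min (lt_min ?_ ?_) ?_ <;> omega
      · have q1 : 0 < (j : ℕ) + 1 := by omega
        have q2 : (j : ℕ) + 1 < ℓ i := by omega
        have q1' : 0 < (j' : ℕ) + 1 := by omega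
        have q2' : (j' : ℕ) + 1 < ℓ i' := by omega
        have inj' : 5 ≤ ℓ i → 5 ≤ ℓ i' → rnk p ℓ i ≠ rnk p ℓ i' :=
          fun a b h => hi (rnk_inj p ℓ i i' a b h).symm
        have c4 : ∀ c, c < 5 → colr (ℓ i) (rnk p ℓ i) (j + 1) = c →
            (c < (j + 1) + (j' + 1) ∧ c + (j + 1) + (j' + 1) < ℓ i + ℓ i') →
            thcol p ℓ (Sum.inr ⟨i, j⟩) < dfun p ℓ i (j + 1) A B (Sum.inr ⟨i', j'⟩) := by
          intro c hc h n
          simp only [thcol, dfun, hi, if_false]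
          rw [h]
          exact num_fin _ _ _ _ _ _ _ (Nat.le_of_lt_succ hc) q1' q2' n.1 n.2 hA' hB'
        simp only [thcol] at e
        have cs : colr (ℓ i) (rnk p ℓ i) (j + 1) = 1 ∨
            colr (ℓ i) (rnk p ℓ i) (j + 1) = 2 ∨ colr (ℓ i) (rnk p ℓ i) (j + 1) = 3 ∨
            colr (ℓ i) (rnk p ℓ i) (j + 1) = 4 := by
          clear c4 inj' hA' hB' hA hB hAB hBA
          omega
        rcases cs with h | h | h | h
        · refine c4 1 (by norm_num) h ?_
          clear c4 inj' hA' hB' hA hB hAB hBA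
          omega
        · have a := colr_two _ _ _ g q1 q2 h
          have b := colr_two _ _ _ g' q1' q2' (e ▸ h)
          exact c4 2 (by norm_num) h (num_two _ _ _ _ _ _ q1 q2 q1' q2' a b inj')
        · have a := colr_three _ _ _ g q1 q2 h
          have b := colr_three _ _ _ g' q1' q2' (e ▸ h)
          refine c4 3 (by norm_num) h ?_
          clear c4 inj' hA' hB' hA hB hAB hBA
          omega
        · have a := colr_four _ _ _ g q1 q2 h (fun q => (rnk_five p ℓ hmono i q).trans_le h5)
            (fun q => (rnk_six p ℓ hmono i q).trans_le h6)
          have b := colr_four _ _ _ g' q1' q2' (e ▸ h)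
            (fun q => (rnk_five p ℓ hmono i' q).trans_le h5)
            (fun q => (rnk_six p ℓ hmono i' q).trans_le h6)
          exact c4 4 (by norm_num) h (num_four _ _ _ _ _ _ a b inj')
  intro x y hne e
  match x, y, hne, e with
  | Sum.inr ⟨i, j⟩, y, hne, e => exact main i j y hne e
  | Sum.inl a, Sum.inr ⟨i, j⟩, hne, e =>
    have h := (main i j _ hne.symm e.symm).trans_eq SimpleGraph.edist_comm
    exact (congrArg (fun n : ℕ => (n : ℕ∞)) e).trans_lt h
  | Sum.inl false, Sum.inl true, hne, e => exact uv
  | Sum.inl true, Sum.inl false, hne, e =>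
    exact uv.trans_eq SimpleGraph.edist_comm
  | Sum.inl false, Sum.inl false, hne, e => exact absurd rfl hne
  | Sum.inl true, Sum.inl true, hne, e => exact absurd rfl hne

theorem stmt5 (p : ℕ) (ℓ : Fin p → ℕ) (hp : 3 ≤ p)
    (hmono : Monotone ℓ) (hpos : ∀ i, 1 ≤ ℓ i) (hsimple : 2 ≤ ℓ ⟨1, by omega⟩) :
    (∃ π : ThetaVert p ℓ → ℕ, IsPackingColoring (thetaGraph p ℓ) 4 π ∧ π (thetaU p ℓ) = 3 ∧ π (thetaV p ℓ) = 3) ↔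
      (pathCount p ℓ 1 = 0 ∧ pathCount p ℓ 2 = 0 ∧ pathCount p ℓ 3 = 0 ∧ pathCount p ℓ 5 ≤ 2 ∧ pathCount p ℓ 5 + pathCount p ℓ 6 ≤ 4) := by
  constructor
  · rintro ⟨π, hπ, hu, hv⟩
    exact stmt5_forward p ℓ hp hpos π hπ hu hv
  · rintro ⟨h1, h2, h3, h5, h6⟩
    have ne : ∀ m, pathCount p ℓ m = 0 → ∀ i, ℓ i ≠ m := by
      intro m hm i hi
      rw [pathCount, Finset.card_eq_zero, Finset.filter_eq_empty_iff] at hm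
      exact hm (Finset.mem_univ i) hi
    refine ⟨thcol p ℓ, stmt5_backward p ℓ hp hmono ?_ h5 h6, rfl, rfl⟩
    intro i
    have := hpos i
    have := ne 1 h1 i
    have := ne 2 h2 i
    have := ne 3 h3 i
    omega
end

section
/- Let Θ = Θ_{ℓ1,…,ℓp} be a generalized theta graph with p ≥ 3. There exists a packing 4-coloring π of Θ with π(u) = π(v) = 2 if and only if n_1 = n_2 = 0 and one of the following conditions holds: (i) n_3 = 1 and n_5 + n_6 + n_7 = 0; or (ii) n_3 = 0 and n_5 + n_6 + n_7 ≤ 2. -/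
/-- The vertex at position `j` on the `i`-th path. -/
def thetaPos (p : ℕ) (ℓ : Fin p → ℕ) (i : Fin p) (j : ℕ) : ThetaVert p ℓ :=
  if j = 0 then Sum.inl false
  else if h : j - 1 < ℓ i - 1 then Sum.inr ⟨i, ⟨j - 1, h⟩⟩ else Sum.inl true

lemma thetaPos_zero (p : ℕ) (ℓ : Fin p → ℕ) (i : Fin p) :
    thetaPos p ℓ i 0 = thetaU p ℓ := by
  simp [thetaPos, thetaU]
  rfl

lemma thetaPos_last (p : ℕ) (ℓ : Fin p → ℕ) (i : Fin p) (h : 1 ≤ ℓ i) :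
    thetaPos p ℓ i (ℓ i) = thetaV p ℓ := by
  have : ℓ i ≠ 0 := by omega
  simp [thetaPos, thetaV, this]
  rfl

lemma thetaPos_inner (p : ℕ) (ℓ : Fin p → ℕ) (i : Fin p) (j : ℕ) (h0 : 0 < j) (h : j < ℓ i) :
    thetaPos p ℓ i j = Sum.inr ⟨i, ⟨j - 1, by omega⟩⟩ := by
  have h1 : j ≠ 0 := by omega
  have h2 : j - 1 < ℓ i - 1 := by omega
  simp [thetaPos, h1, h2]
  rfl

lemma thetaPos_ne_cross (p : ℕ) (ℓ : Fin p → ℕ) (i i' : Fin p) (j j' : ℕ) (hi : i ≠ i')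
    (h0 : 0 < j) (h : j < ℓ i) (h0' : 0 < j') (h' : j' < ℓ i') :
    thetaPos p ℓ i j ≠ thetaPos p ℓ i' j' := by
  rw [thetaPos_inner p ℓ i j h0 h, thetaPos_inner p ℓ i' j' h0' h']
  intro e
  have e2 := Sum.inr.inj e
  exact hi (congrArg Sigma.fst e2)

lemma thetaPos_ne (p : ℕ) (ℓ : Fin p → ℕ) (i : Fin p) (j j' : ℕ) (hj : j < j')
    (h' : j' ≤ ℓ i) : thetaPos p ℓ i j ≠ thetaPos p ℓ i j' := by
  intro e
  rcases Nat.eq_zero_or_pos j with rfl | h0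
  · rcases Nat.lt_or_eq_of_le h' with h1 | rfl
    · rw [thetaPos_zero, thetaPos_inner p ℓ i j' hj h1] at e
      exact Sum.inl_ne_inr e
    · rw [thetaPos_zero, thetaPos_last p ℓ i (by omega)] at e
      exact absurd (Sum.inl.inj e) (by decide)
  · rw [thetaPos_inner p ℓ i j h0 (by omega)] at e
    rcases Nat.lt_or_eq_of_le h' with h1 | rfl
    · rw [thetaPos_inner p ℓ i j' (by omega) h1] at e
      have e2 := Sum.inr.inj e
      rw [Sigma.mk.injEq] at e2
      have e3 := eq_of_heq e2.2
      rw [Fin.mk.injEq] at e3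
      omega
    · rw [thetaPos_last p ℓ i (by omega)] at e
      exact Sum.inr_ne_inl e

lemma thetaPos_adj (p : ℕ) (ℓ : Fin p → ℕ) (i : Fin p) (j : ℕ) (hj : j < ℓ i) :
    (thetaGraph p ℓ).Adj (thetaPos p ℓ i j) (thetaPos p ℓ i (j + 1)) := by
  unfold thetaGraph
  rw [SimpleGraph.fromRel_adj]
  refine ⟨thetaPos_ne p ℓ i j (j + 1) (by omega) (by omega), ?_⟩
  rcases Nat.eq_zero_or_pos j with rfl | h0
  · rcases Nat.lt_or_eq_of_le (show 0 + 1 ≤ ℓ i by omega) with h1 | h1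
    · left
      rw [thetaPos_zero, thetaPos_inner p ℓ i (0 + 1) (by omega) h1]
      exact Or.inl ⟨rfl, rfl⟩
    · left
      have := thetaPos_last p ℓ i (by omega)
      rw [← h1] at this
      rw [thetaPos_zero, this]
      exact ⟨rfl, rfl, i, by omega⟩
  · rcases Nat.lt_or_eq_of_le (show j + 1 ≤ ℓ i by omega) with h1 | h1
    · left
      rw [thetaPos_inner p ℓ i j h0 hj, thetaPos_inner p ℓ i (j + 1) (by omega) h1]
      refine ⟨rfl, ?_⟩
      show j - 1 + 1 = j + 1 - 1
      omega
    · right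
      have := thetaPos_last p ℓ i (by omega)
      rw [← h1] at this
      rw [thetaPos_inner p ℓ i j h0 hj, this]
      refine Or.inr ⟨rfl, ?_⟩
      show j - 1 + 2 = ℓ i
      omega

lemma thetaPos_edist (p : ℕ) (ℓ : Fin p → ℕ) (i : Fin p) (j k : ℕ) (h : j + k ≤ ℓ i) :
    (thetaGraph p ℓ).edist (thetaPos p ℓ i j) (thetaPos p ℓ i (j + k)) ≤ (k : ℕ∞) := by
  induction k with
  | zero => simp
  | succ k ih =>
    have h1 := ih (by omega)
    have h2 := thetaPos_adj p ℓ i (j + k) (by omega)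
    have h3 := (SimpleGraph.edist_eq_one_iff_adj (G := thetaGraph p ℓ)).2 h2
    calc _ ≤ _ := SimpleGraph.edist_triangle (v := thetaPos p ℓ i (j + k))
      _ ≤ (k : ℕ∞) + 1 := by
        gcongr
        exact h3.le
      _ = _ := by push_cast; rfl

/-- Analysis of the colors near the end-vertex `u`. -/
lemma near_end (p : ℕ) (hp : 3 ≤ p) (ℓ : Fin p → ℕ) (c : Fin p → ℕ → ℕ)
    (hl : ∀ i, 3 ≤ ℓ i) (h0 : ∀ i, c i 0 = 2)
    (hb : ∀ i j, 1 ≤ c i j ∧ c i j ≤ 4)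
    (hs : ∀ i j j', j < j' → j' ≤ ℓ i → c i j = c i j' → c i j < j' - j)
    (hc : ∀ i i' j j', i ≠ i' → 0 < j → j < ℓ i → 0 < j' → j' < ℓ i' → c i j = c i' j' →
      c i j < j + j') :
    (∀ i, c i 1 ≠ 3) ∧
    (∀ i, (c i 1 = 4 ∨ c i 2 = 4) ∨ c i 2 = 3) ∧
    (∀ i i', (c i 1 = 4 ∨ c i 2 = 4) → (c i' 1 = 4 ∨ c i' 2 = 4) → i = i') := by
  have key : ∀ i, (c i 1 = 3 ∨ c i 1 = 4 ∨ c i 2 = 4) ∨ c i 2 = 3 := by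
    intro i
    have := hl i
    have a0 := h0 i
    have a1 := hs i 0 1 (by omega) (by omega)
    have a2 := hs i 0 2 (by omega) (by omega)
    have a3 := hs i 1 2 (by omega) (by omega)
    have b1 := hb i 1
    have b2 := hb i 2
    omega
  have four : ∀ i i', (c i 1 = 4 ∨ c i 2 = 4) → (c i' 1 = 4 ∨ c i' 2 = 4) → i = i' := by
    intro i i' h h'
    by_contra hne
    have := hl i
    have := hl i'
    have a1 := hc i i' 1 1 hne (by omega) (by omega) (by omega) (by omega)
    have a2 := hc i i' 1 2 hne (by omega) (by omega) (by omega) (by omega)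
    have a3 := hc i i' 2 1 hne (by omega) (by omega) (by omega) (by omega)
    have a4 := hc i i' 2 2 hne (by omega) (by omega) (by omega) (by omega)
    omega
  have three : ∀ i, c i 1 ≠ 3 := by
    intro i h3
    have other : ∀ k, i ≠ k → c k 1 = 4 ∨ c k 2 = 4 := by
      intro k hk
      have := hl i
      have := hl k
      have a1 := hc i k 1 1 hk (by omega) (by omega) (by omega) (by omega)
      have a2 := hc i k 1 2 hk (by omega) (by omega) (by omega) (by omega)
      have := key k
      omega
    have : ∃ a b : Fin p, i ≠ a ∧ i ≠ b ∧ a ≠ b := by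
      by_cases e0 : i.val = 0
      · exact ⟨⟨1, by omega⟩, ⟨2, by omega⟩, by simp [Fin.ext_iff]; omega,
          by simp [Fin.ext_iff]; omega, by simp⟩
      · by_cases e1 : i.val = 1
        · exact ⟨⟨0, by omega⟩, ⟨2, by omega⟩, by simp [Fin.ext_iff]; omega,
            by simp [Fin.ext_iff]; omega, by simp⟩
        · exact ⟨⟨0, by omega⟩, ⟨1, by omega⟩, by simp [Fin.ext_iff]; omega,
            by simp [Fin.ext_iff]; omega, by simp⟩
    obtain ⟨a, b, ha, hb', hab⟩ := this
    exact hab (four a b (other a ha) (other b hb'))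
  refine ⟨three, ?_, four⟩
  intro i
  have := key i
  have := three i
  omega

lemma count567 (p : ℕ) (ℓ : Fin p → ℕ) :
    pathCount p ℓ 5 + pathCount p ℓ 6 + pathCount p ℓ 7 =
      (Finset.univ.filter (fun i : Fin p => 5 ≤ ℓ i ∧ ℓ i ≤ 7)).card := by
  unfold pathCount
  rw [← Finset.card_union_of_disjoint, ← Finset.card_union_of_disjoint]
  · congr 1
    ext i
    simp only [Finset.mem_union, Finset.mem_filter, Finset.mem_univ, true_and]
    omega
  · rw [Finset.disjoint_left]
    intro i
    simp only [Finset.mem_union, Finset.mem_filter, Finset.mem_univ, true_and]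
    omega
  · rw [Finset.disjoint_left]
    intro i
    simp only [Finset.mem_filter, Finset.mem_univ, true_and]
    omega

lemma pathCount_zero (p : ℕ) (ℓ : Fin p → ℕ) (m : ℕ) :
    pathCount p ℓ m = 0 ↔ ∀ i, ℓ i ≠ m := by
  simp [pathCount, Finset.filter_eq_empty_iff]

lemma stmt6_forward (p : ℕ) (ℓ : Fin p → ℕ) (hp : 3 ≤ p) (hpos : ∀ i, 1 ≤ ℓ i)
    (π : ThetaVert p ℓ → ℕ) (hπ : IsPackingColoring (thetaGraph p ℓ) 4 π)
    (hu : π (thetaU p ℓ) = 2) (hv : π (thetaV p ℓ) = 2) :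
    (pathCount p ℓ 1 = 0 ∧ pathCount p ℓ 2 = 0 ∧
        ((pathCount p ℓ 3 = 1 ∧ pathCount p ℓ 5 + pathCount p ℓ 6 + pathCount p ℓ 7 = 0) ∨
         (pathCount p ℓ 3 = 0 ∧ pathCount p ℓ 5 + pathCount p ℓ 6 + pathCount p ℓ 7 ≤ 2))) := by
  obtain ⟨hb, hd⟩ := hπ
  have h0 : ∀ i, π (thetaPos p ℓ i 0) = 2 := fun i => by rw [thetaPos_zero, hu]
  have h1 : ∀ i, π (thetaPos p ℓ i (ℓ i)) = 2 := fun i => by rw [thetaPos_last _ _ _ (hpos i), hv]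
  have hs : ∀ i j j', j < j' → j' ≤ ℓ i → π (thetaPos p ℓ i j) = π (thetaPos p ℓ i j') →
      π (thetaPos p ℓ i j) < j' - j := by
    intro i j j' hj hj' e
    have a := hd _ _ (thetaPos_ne p ℓ i j j' hj hj') e
    have b := thetaPos_edist p ℓ i j (j' - j) (by omega)
    rw [show j + (j' - j) = j' by omega] at b
    exact_mod_cast a.trans_le b
  have hl : ∀ i, 3 ≤ ℓ i := by
    intro i
    have := hs i 0 (ℓ i) (hpos i) le_rfl (by rw [h0, h1])
    rw [h0] at this
    omega
  have hcu : ∀ i i' j j', i ≠ i' → 0 < j → j < ℓ i → 0 < j' → j' < ℓ i' →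
      π (thetaPos p ℓ i j) = π (thetaPos p ℓ i' j') → π (thetaPos p ℓ i j) < j + j' := by
    intro i i' j j' hi hj0 hj hj0' hj' e
    have a := hd _ _ (thetaPos_ne_cross p ℓ i i' j j' hi hj0 hj hj0' hj') e
    have b := thetaPos_edist p ℓ i 0 j (by omega)
    have b' := thetaPos_edist p ℓ i' 0 j' (by omega)
    rw [zero_add, thetaPos_zero] at b b'
    rw [SimpleGraph.edist_comm] at b
    have t := (SimpleGraph.edist_triangle (G := thetaGraph p ℓ) (u := thetaPos p ℓ i j)
      (v := thetaU p ℓ) (w := thetaPos p ℓ i' j')).trans (add_le_add b b')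
    exact_mod_cast a.trans_le t
  have hcv : ∀ i i' j j', i ≠ i' → 0 < j → j < ℓ i → 0 < j' → j' < ℓ i' →
      π (thetaPos p ℓ i j) = π (thetaPos p ℓ i' j') →
      π (thetaPos p ℓ i j) < (ℓ i - j) + (ℓ i' - j') := by
    intro i i' j j' hi hj0 hj hj0' hj' e
    have a := hd _ _ (thetaPos_ne_cross p ℓ i i' j j' hi hj0 hj hj0' hj') e
    have b := thetaPos_edist p ℓ i j (ℓ i - j) (by omega)
    have b' := thetaPos_edist p ℓ i' j' (ℓ i' - j') (by omega)
    rw [show j + (ℓ i - j) = ℓ i by omega, thetaPos_last _ _ _ (hpos i)] at b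
    rw [show j' + (ℓ i' - j') = ℓ i' by omega, thetaPos_last _ _ _ (hpos i')] at b'
    rw [SimpleGraph.edist_comm] at b'
    have t := (SimpleGraph.edist_triangle (G := thetaGraph p ℓ) (u := thetaPos p ℓ i j)
      (v := thetaV p ℓ) (w := thetaPos p ℓ i' j')).trans (add_le_add b b')
    exact_mod_cast a.trans_le t
  obtain ⟨u3, u4, uu⟩ := near_end p hp ℓ (fun i j => π (thetaPos p ℓ i j)) hl h0
    (fun i j => hb _) hs hcu
  obtain ⟨v3, v4, vv⟩ := near_end p hp ℓ (fun i j => π (thetaPos p ℓ i (ℓ i - j))) hl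
    (fun i => by simpa using h1 i) (fun i j => hb _)
    (by
      intro i j j' hj hj' e
      have := hs i (ℓ i - j') (ℓ i - j) (by omega) (by omega) e.symm
      omega)
    (by
      intro i i' j j' hi hj0 hj hj0' hj' e
      have := hcv i i' (ℓ i - j) (ℓ i' - j') hi (by omega) (by omega) (by omega) (by omega) e
      omega)
  have len3 : ∀ i, ℓ i = 3 → (π (thetaPos p ℓ i 1) = 4 ∨ π (thetaPos p ℓ i 2) = 4) ∧
      (π (thetaPos p ℓ i (ℓ i - 1)) = 4 ∨ π (thetaPos p ℓ i (ℓ i - 2)) = 4) := by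
    intro i hi
    have a := u3 i
    have b := u4 i
    have a' := v3 i
    have b' := v4 i
    rw [hi] at a' b' ⊢
    simp only [show 3 - 1 = 2 from rfl, show 3 - 2 = 1 from rfl] at a' b' ⊢
    omega
  have len567 : ∀ i, 5 ≤ ℓ i ∧ ℓ i ≤ 7 →
      (π (thetaPos p ℓ i 1) = 4 ∨ π (thetaPos p ℓ i 2) = 4) ∨
      (π (thetaPos p ℓ i (ℓ i - 1)) = 4 ∨ π (thetaPos p ℓ i (ℓ i - 2)) = 4) := by
    intro i hi
    have b := u4 i
    have b' := v4 i
    have d := hs i 2 (ℓ i - 2) (by omega) (by omega)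
    omega
  rw [count567]
  have card3 : pathCount p ℓ 3 ≤ 1 := by
    unfold pathCount
    rw [Finset.card_le_one]
    intro a ha b hb
    simp only [Finset.mem_filter, Finset.mem_univ, true_and] at ha hb
    exact uu a b (len3 a ha).1 (len3 b hb).1
  refine ⟨?_, ?_, ?_⟩
  · rw [pathCount_zero]
    intro i
    have := hl i
    omega
  · rw [pathCount_zero]
    intro i
    have := hl i
    omega
  · by_cases e : pathCount p ℓ 3 = 0
    · right
      refine ⟨e, ?_⟩
      let U := Finset.univ.filter
        (fun i : Fin p => π (thetaPos p ℓ i 1) = 4 ∨ π (thetaPos p ℓ i 2) = 4)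
      let W := Finset.univ.filter (fun i : Fin p =>
        π (thetaPos p ℓ i (ℓ i - 1)) = 4 ∨ π (thetaPos p ℓ i (ℓ i - 2)) = 4)
      have hU : U.card ≤ 1 := by
        rw [Finset.card_le_one]
        intro a ha b hb
        exact uu a b (Finset.mem_filter.1 ha).2 (Finset.mem_filter.1 hb).2
      have hW : W.card ≤ 1 := by
        rw [Finset.card_le_one]
        intro a ha b hb
        exact vv a b (Finset.mem_filter.1 ha).2 (Finset.mem_filter.1 hb).2
      have hsub : (Finset.univ.filter (fun i : Fin p => 5 ≤ ℓ i ∧ ℓ i ≤ 7)) ⊆ U ∪ W := by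
        intro i hi
        have := len567 i (Finset.mem_filter.1 hi).2
        rw [Finset.mem_union, Finset.mem_filter, Finset.mem_filter]
        rcases this with h | h
        · exact Or.inl ⟨Finset.mem_univ _, h⟩
        · exact Or.inr ⟨Finset.mem_univ _, h⟩
      have := (Finset.card_le_card hsub).trans (Finset.card_union_le U W)
      omega
    · left
      refine ⟨by omega, ?_⟩
      rw [pathCount_zero] at e
      push Not at e
      obtain ⟨s, hs3⟩ := e
      rw [Finset.card_eq_zero, Finset.filter_eq_empty_iff]
      intro t _ ht
      have hts : t = s := by
        rcases len567 t ht with h | h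
        · exact uu t s h (len3 s hs3).1
        · exact vv t s h (len3 s hs3).2
      subst hts
      omega

/-- The color at position `j` of a path of length `L` with no color 4 near its ends. -/
def stdCol (L j : ℕ) : ℕ :=
  if L - j = 1 ∨ L - j = 3 then 1
  else if L - j = 2 then 3
  else if L - j = 4 then (if L % 4 = 1 ∨ L % 4 = 2 then 4 else 2)
  else if L - j = 5 ∧ L % 4 = 3 then 4
  else if j % 4 = 0 then 2
  else if j % 4 = 2 then 3
  else 1

/-- The color at position `j` of a path of length `L` with color 4 in position 2. -/
def uCol (L j : ℕ) : ℕ :=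
  if j = 1 then 1
  else if j = 2 then 4
  else if L - j = 2 then 3
  else if L - j = 3 ∧ L = 7 then 2
  else 1

/-- The color at position `j` of a path of length `L` of kind `k`. -/
def kindCol (k L j : ℕ) : ℕ :=
  if k = 0 then stdCol L j else if k = 1 then uCol L j else uCol L (L - j)

/-- Compatibility between kinds and lengths. -/
def KindOK (k L : ℕ) : Prop :=
  (k = 0 ∧ (L = 4 ∨ 8 ≤ L)) ∨ (k = 1 ∧ (L = 3 ∨ (5 ≤ L ∧ L ≤ 7))) ∨ (k = 2 ∧ 5 ≤ L ∧ L ≤ 7)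

lemma kindCol_spec (k L j : ℕ) (h : KindOK k L) (h0 : 0 < j) (hj : j < L) :
    1 ≤ kindCol k L j ∧ kindCol k L j ≤ 4 ∧
    (kindCol k L j = 2 → 3 ≤ j ∧ 3 ≤ L - j) ∧
    (kindCol k L j = 3 → 2 ≤ j ∧ 2 ≤ L - j) ∧
    (kindCol k L j = 4 → (k = 0 ∧ 4 ≤ j ∧ 4 ≤ L - j) ∨ (k = 1 ∧ j = 2 ∧ (L = 3 ∨ 3 ≤ L - j)) ∨
      (k = 2 ∧ L - j = 2 ∧ 3 ≤ j)) := by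
  rcases h with ⟨rfl, h⟩ | ⟨rfl, h⟩ | ⟨rfl, h⟩
  · have e : kindCol 0 L j = stdCol L j := rfl
    rw [e]
    unfold stdCol
    refine ⟨?_, ?_, ?_, ?_, ?_⟩ <;> split_ifs <;> omega
  · have e : kindCol 1 L j = uCol L j := rfl
    rw [e]
    unfold uCol
    refine ⟨?_, ?_, ?_, ?_, ?_⟩ <;> split_ifs <;> omega
  · have e : kindCol 2 L j = uCol L (L - j) := rfl
    rw [e]
    unfold uCol
    refine ⟨?_, ?_, ?_, ?_, ?_⟩ <;> split_ifs <;> omega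

lemma stdCol_same (L j j' : ℕ) (h : L = 4 ∨ 8 ≤ L) (h0 : 0 < j) (hj : j < j')
    (hj' : j' < L) (e : stdCol L j = stdCol L j') : stdCol L j < j' - j := by
  by_contra hlt
  unfold stdCol at e hlt
  split_ifs at e hlt <;> omega

lemma uCol_same (L j j' : ℕ) (h : L = 3 ∨ (5 ≤ L ∧ L ≤ 7)) (h0 : 0 < j) (hj : j < j')
    (hj' : j' < L) (e : uCol L j = uCol L j') : uCol L j < j' - j := by
  by_contra hlt
  unfold uCol at e hlt
  split_ifs at e hlt <;> omega

lemma kindCol_same (k L j j' : ℕ) (h : KindOK k L) (h0 : 0 < j) (hj : j < j')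
    (hj' : j' < L) (e : kindCol k L j = kindCol k L j') : kindCol k L j < j' - j := by
  rcases h with ⟨rfl, h⟩ | ⟨rfl, h⟩ | ⟨rfl, h⟩
  · exact stdCol_same L j j' h h0 hj hj' e
  · exact uCol_same L j j' h h0 hj hj' e
  · have e' : uCol L (L - j) = uCol L (L - j') := e
    have := uCol_same L (L - j') (L - j) (Or.inr h) (by omega) (by omega) (by omega) e'.symm
    show uCol L (L - j) < j' - j
    omega

/-- A lower bound for the distance to position `j` of path `i`. -/
def distLB (p : ℕ) (ℓ : Fin p → ℕ) (i : Fin p) (j : ℕ) : ThetaVert p ℓ → ℕ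
  | Sum.inl false => min j (ℓ i - j + 3)
  | Sum.inl true => min (ℓ i - j) (j + 3)
  | Sum.inr ⟨i', k⟩ =>
      if i' = i then min ((j - (k + 1)) + (k + 1 - j))
        (min (min j (ℓ i - j + 3) + (k + 1)) (min (ℓ i - j) (j + 3) + (ℓ i - (k + 1))))
      else min (min j (ℓ i - j + 3) + (k + 1)) (min (ℓ i - j) (j + 3) + (ℓ i' - (k + 1)))

lemma distLB_rel (p : ℕ) (ℓ : Fin p → ℕ) (hl : ∀ i, 3 ≤ ℓ i) (i : Fin p) (j : ℕ)
    (hj : j ≤ ℓ i) (x y : ThetaVert p ℓ) (h : thetaRel p ℓ x y) :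
    distLB p ℓ i j x ≤ distLB p ℓ i j y + 1 ∧ distLB p ℓ i j y ≤ distLB p ℓ i j x + 1 := by
  have h3 := hl i
  have f1 : min j (ℓ i - j + 3) ≤ j := min_le_left _ _
  have f2 : min (ℓ i - j) (j + 3) ≤ ℓ i - j := min_le_left _ _
  have f3 : min j (ℓ i - j + 3) ≤ min (ℓ i - j) (j + 3) + 3 := by omega
  have f4 : min (ℓ i - j) (j + 3) ≤ min j (ℓ i - j + 3) + 3 := by omega
  rcases x with a | ⟨i1, k1⟩ <;> rcases y with b | ⟨i2, k2⟩
  · obtain ⟨_, _, m, hm⟩ := h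
    have := hl m
    omega
  · have h2 := hl i2
    have hk := k2.2
    rcases h with ⟨rfl, h⟩ | ⟨rfl, h⟩
    · simp only [distLB]
      generalize min j (ℓ i - j + 3) = a at *
      generalize min (ℓ i - j) (j + 3) = b at *
      split_ifs with e
      · subst e
        omega
      · omega
    · simp only [distLB]
      generalize min j (ℓ i - j + 3) = a at *
      generalize min (ℓ i - j) (j + 3) = b at *
      split_ifs with e
      · subst e
        omega
      · omega
  · exact h.elim
  · obtain ⟨e1, h⟩ := h
    have e1 := Fin.ext e1
    subst e1
    have hk := k1.2
    have hk2 := k2.2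
    simp only [distLB]
    generalize min j (ℓ i - j + 3) = a at *
    generalize min (ℓ i - j) (j + 3) = b at *
    split_ifs with e
    · subst e
      omega
    · omega

lemma distLB_adj (p : ℕ) (ℓ : Fin p → ℕ) (hl : ∀ i, 3 ≤ ℓ i) (i : Fin p) (j : ℕ)
    (hj : j ≤ ℓ i) (x y : ThetaVert p ℓ) (h : (thetaGraph p ℓ).Adj x y) :
    distLB p ℓ i j y ≤ distLB p ℓ i j x + 1 := by
  unfold thetaGraph at h
  rw [SimpleGraph.fromRel_adj] at h
  rcases h.2 with h | h
  · exact (distLB_rel p ℓ hl i j hj x y h).2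
  · exact (distLB_rel p ℓ hl i j hj y x h).1

lemma le_edist_of_lip {V : Type*} (G : SimpleGraph V) (F : V → ℕ)
    (hF : ∀ x y, G.Adj x y → F y ≤ F x + 1) (x y : V) (hx : F x = 0) (c : ℕ) (hc : c < F y) :
    (c : ℕ∞) < G.edist x y := by
  have walk : ∀ {a b : V} (w : G.Walk a b), F b ≤ F a + w.length := by
    intro a b w
    induction w with
    | nil => simp
    | cons h w ih =>
      have := hF _ _ h
      rw [SimpleGraph.Walk.length_cons]
      omega
  refine lt_of_lt_of_le (b := ((F y : ℕ) : ℕ∞)) (by exact_mod_cast hc) ?_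
  unfold SimpleGraph.edist
  refine le_iInf fun w => ?_
  have := walk w
  rw [hx, zero_add] at this
  exact_mod_cast this

lemma lt_edist_swap {V : Type*} (G : SimpleGraph V) (x y : V) (c : ℕ∞)
    (h : c < G.edist x y) : c < G.edist y x := by
  rwa [SimpleGraph.edist_comm]

/-- The coloring built from kinds. -/
def kindColoring (p : ℕ) (ℓ : Fin p → ℕ) (kind : Fin p → ℕ) : ThetaVert p ℓ → ℕ
  | Sum.inl _ => 2
  | Sum.inr ⟨i, k⟩ => kindCol (kind i) (ℓ i) (k + 1)

lemma kindColoring_packing (p : ℕ) (ℓ : Fin p → ℕ) (kind : Fin p → ℕ) (hp : 3 ≤ p)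
    (hk : ∀ i, KindOK (kind i) (ℓ i))
    (h1 : ∀ i i', kind i = 1 → kind i' = 1 → i = i')
    (h2 : ∀ i i', kind i = 2 → kind i' = 2 → i = i')
    (h12 : ∀ i i', kind i = 1 → kind i' = 2 → ℓ i ≠ 3) :
    IsPackingColoring (thetaGraph p ℓ) 4 (kindColoring p ℓ kind) := by
  have hl : ∀ i, 3 ≤ ℓ i := by
    intro i
    have := hk i
    unfold KindOK at this
    omega
  have huv : (2 : ℕ∞) < (thetaGraph p ℓ).edist (thetaU p ℓ) (thetaV p ℓ) := by
    refine le_edist_of_lip _ (distLB p ℓ ⟨0, by omega⟩ 0)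
      (fun x y h => distLB_adj p ℓ hl _ _ (by omega) x y h) _ _ ?_ 2 ?_
    · simp [distLB, thetaU]
    · have := hl ⟨0, by omega⟩
      simp only [distLB, thetaV]
      omega
  have hend : ∀ (i : Fin p) (k : Fin (ℓ i - 1)) (b : Bool),
      kindCol (kind i) (ℓ i) (k + 1) = 2 →
      (2 : ℕ∞) < (thetaGraph p ℓ).edist (Sum.inr ⟨i, k⟩ : ThetaVert p ℓ) (Sum.inl b) := by
    intro i k b h
    have hk2 := k.2
    have sp := (kindCol_spec (kind i) (ℓ i) (k + 1) (hk i) (by omega) (by omega)).2.2.1 h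
    refine le_edist_of_lip _ (distLB p ℓ i (k + 1))
      (fun x y h => distLB_adj p ℓ hl _ _ (by omega) x y h) _ _ ?_ 2 ?_
    · simp [distLB]
    · cases b <;> simp only [distLB] <;> omega
  constructor
  · rintro (b | ⟨i, k⟩)
    · simp [kindColoring]
    · have hk2 := k.2
      have sp := kindCol_spec (kind i) (ℓ i) (k + 1) (hk i) (by omega) (by omega)
      exact ⟨sp.1, sp.2.1⟩
  · rintro (a | ⟨i, k⟩) (b | ⟨i', k'⟩) hne e
    · cases a <;> cases b
      · exact absurd rfl hne
      · exact huv
      · exact lt_edist_swap _ _ _ _ huv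
      · exact absurd rfl hne
    · exact lt_edist_swap _ _ _ _ (hend i' k' a e.symm)
    · rw [e]
      exact hend i k b e
    · have hkk := k.2
      have hkk' := k'.2
      have sp := kindCol_spec (kind i) (ℓ i) (k + 1) (hk i) (by omega) (by omega)
      have sp' := kindCol_spec (kind i') (ℓ i') (k' + 1) (hk i') (by omega) (by omega)
      refine le_edist_of_lip _ (distLB p ℓ i (k + 1))
        (fun x y h => distLB_adj p ℓ hl _ _ (by omega) x y h) _ _ ?_ _ ?_
      · simp [distLB]
      · simp only [kindColoring] at e ⊢
        by_cases ei : i' = i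
        · subst ei
          simp only [distLB, if_true]
          have hkne : (k : ℕ) ≠ k' := by
            intro h
            exact hne (by rw [Fin.ext h])
          rcases Nat.lt_or_gt_of_ne hkne with hlt | hlt
          · have := kindCol_same _ _ (k + 1) (k' + 1) (hk i') (by omega) (by omega) (by omega) e
            omega
          · have := kindCol_same _ _ (k' + 1) (k + 1) (hk i') (by omega) (by omega) (by omega)
              e.symm
            omega
        · simp only [distLB, ei, if_false]
          have g1 := h1 i i'
          have g2 := h2 i i'
          have g3 := h12 i i'
          have g4 := h12 i' i
          have ei' : i ≠ i' := fun h => ei h.symm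
          simp only [ei', imp_false] at g1 g2
          rw [← e] at sp'
          generalize kindCol (kind i) (ℓ i) (k + 1) = c at sp sp' ⊢
          have : c = 1 ∨ c = 2 ∨ c = 3 ∨ c = 4 := by omega
          rcases this with rfl | rfl | rfl | rfl
          · refine lt_min ?_ ?_ <;> clear sp sp' g1 g2 g3 g4 <;> omega
          · have s1 := sp.2.2.1 rfl
            have s2 := sp'.2.2.1 rfl
            refine lt_min ?_ ?_ <;> clear sp sp' g1 g2 g3 g4 <;> omega
          · have s1 := sp.2.2.2.1 rfl
            have s2 := sp'.2.2.2.1 rfl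
            refine lt_min ?_ ?_ <;> clear sp sp' g1 g2 g3 g4 <;> omega
          · have s1 := sp.2.2.2.2 rfl
            have s2 := sp'.2.2.2.2 rfl
            clear sp sp'
            rcases s1 with ⟨q, s1⟩ | ⟨q, s1⟩ | ⟨q, s1⟩ <;>
            rcases s2 with ⟨q', s2⟩ | ⟨q', s2⟩ | ⟨q', s2⟩ <;>
            refine lt_min ?_ ?_ <;> omega

lemma exists_kind (p : ℕ) (ℓ : Fin p → ℕ) (hpos : ∀ i, 1 ≤ ℓ i)
    (h : (pathCount p ℓ 1 = 0 ∧ pathCount p ℓ 2 = 0 ∧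
        ((pathCount p ℓ 3 = 1 ∧ pathCount p ℓ 5 + pathCount p ℓ 6 + pathCount p ℓ 7 = 0) ∨
         (pathCount p ℓ 3 = 0 ∧ pathCount p ℓ 5 + pathCount p ℓ 6 + pathCount p ℓ 7 ≤ 2)))) :
    ∃ kind : Fin p → ℕ, (∀ i, KindOK (kind i) (ℓ i)) ∧
    (∀ i i', kind i = 1 → kind i' = 1 → i = i') ∧
    (∀ i i', kind i = 2 → kind i' = 2 → i = i') ∧
    (∀ i i', kind i = 1 → kind i' = 2 → ℓ i ≠ 3) := by
  rw [count567] at h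
  obtain ⟨n1, n2, h⟩ := h
  rw [pathCount_zero] at n1 n2
  rcases h with ⟨n3, n5⟩ | ⟨n3, n5⟩
  · have c3 : pathCount p ℓ 3 ≤ 1 := by omega
    unfold pathCount at c3
    rw [Finset.card_le_one] at c3
    simp only [Finset.mem_filter, Finset.mem_univ, true_and] at c3
    rw [Finset.card_eq_zero, Finset.filter_eq_empty_iff] at n5
    refine ⟨fun i => if ℓ i = 3 then 1 else 0, ?_, ?_, ?_, ?_⟩
    · intro i
      have a1 := n1 i
      have a2 := n2 i
      have a3 := hpos i
      have a5 := n5 (Finset.mem_univ i)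
      unfold KindOK
      simp only
      split_ifs <;> omega
    · intro i i' hi hi'
      refine c3 i ?_ i' ?_
      · by_contra hh
        simp [hh] at hi
      · by_contra hh
        simp [hh] at hi'
    · intro i i' hi
      simp only at hi
      split_ifs at hi <;> omega
    · intro i i' _ hi
      simp only at hi
      split_ifs at hi <;> omega
  · rw [pathCount_zero] at n3
    have base : ∀ i, ¬ (5 ≤ ℓ i ∧ ℓ i ≤ 7) → (ℓ i = 4 ∨ 8 ≤ ℓ i) := by
      intro i
      have a1 := n1 i
      have a2 := n2 i
      have a3 := n3 i
      have a4 := hpos i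
      omega
    rcases Finset.eq_empty_or_nonempty
      (Finset.univ.filter (fun i : Fin p => 5 ≤ ℓ i ∧ ℓ i ≤ 7)) with he | ⟨a, ha⟩
    · rw [Finset.filter_eq_empty_iff] at he
      exact ⟨fun _ => 0, fun i => Or.inl ⟨rfl, base i (he (Finset.mem_univ i))⟩,
        fun i i' h => by simp at h, fun i i' h => by simp at h, fun i i' h => by simp at h⟩
    · have hc := Finset.card_erase_of_mem ha
      have hc1 : ((Finset.univ.filter (fun i : Fin p => 5 ≤ ℓ i ∧ ℓ i ≤ 7)).erase a).card ≤ 1 := by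
        omega
      rw [Finset.card_le_one] at hc1
      simp only [Finset.mem_erase, Finset.mem_filter, Finset.mem_univ, true_and] at hc1 ha
      refine ⟨fun i => if i = a then 1 else if 5 ≤ ℓ i ∧ ℓ i ≤ 7 then 2 else 0, ?_, ?_, ?_, ?_⟩
      · intro i
        have b := base i
        unfold KindOK
        simp only
        by_cases e : i = a
        · subst e
          rw [if_pos rfl]
          omega
        · simp only [e, if_false]
          split_ifs <;> omega
      · have : ∀ i, (if i = a then 1 else if 5 ≤ ℓ i ∧ ℓ i ≤ 7 then 2 else 0) = 1 → i = a := by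
          intro i hi
          by_contra h
          rw [if_neg h] at hi
          split_ifs at hi <;> omega
        intro i i' hi hi'
        rw [this i hi, this i' hi']
      · have : ∀ i, (if i = a then 1 else if 5 ≤ ℓ i ∧ ℓ i ≤ 7 then 2 else 0) = 2 →
            i ≠ a ∧ 5 ≤ ℓ i ∧ ℓ i ≤ 7 := by
          intro i hi
          by_cases h1 : i = a
          · rw [if_pos h1] at hi
            omega
          · rw [if_neg h1] at hi
            refine ⟨h1, ?_⟩
            by_contra h2
            rw [if_neg h2] at hi
            omega
        intro i i' hi hi'
        exact hc1 i (this i hi) i' (this i' hi')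
      · intro i i' _ _
        exact n3 i

theorem stmt6 (p : ℕ) (ℓ : Fin p → ℕ) (hp : 3 ≤ p)
    (hmono : Monotone ℓ) (hpos : ∀ i, 1 ≤ ℓ i) (hsimple : 2 ≤ ℓ ⟨1, by omega⟩) :
    (∃ π : ThetaVert p ℓ → ℕ, IsPackingColoring (thetaGraph p ℓ) 4 π ∧ π (thetaU p ℓ) = 2 ∧ π (thetaV p ℓ) = 2) ↔
      (pathCount p ℓ 1 = 0 ∧ pathCount p ℓ 2 = 0 ∧
        ((pathCount p ℓ 3 = 1 ∧ pathCount p ℓ 5 + pathCount p ℓ 6 + pathCount p ℓ 7 = 0) ∨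
         (pathCount p ℓ 3 = 0 ∧ pathCount p ℓ 5 + pathCount p ℓ 6 + pathCount p ℓ 7 ≤ 2))) := by
  constructor
  · rintro ⟨π, hπ, hu, hv⟩
    exact stmt6_forward p ℓ hp hpos π hπ hu hv
  · intro h
    obtain ⟨kind, hk, h1, h2, h12⟩ := exists_kind p ℓ hpos h
    exact ⟨kindColoring p ℓ kind, kindColoring_packing p ℓ kind hp hk h1 h2 h12, rfl, rfl⟩
end
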